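/- arXiv:2303.05402 — 2 statements merged into one kernel-verified Lean document; each statement's English description precedes it below -/
import Mathlib

section
/- The infinite series identity $\sum_{k=0}^{\infty}\Big(\frac{1}{4}\Big)^k\frac{((1)_k)^2}{(5/4)_k\,(7/4)_k}\Big\{ \frac{5+6k}{1+2k}\big[H_k^{(2)}+4\big]-\frac{24+32k}{(1+2k)^3}\Big\} = 24G - 24\beta(4)$ holds. -/
open scoped BigOperators

/-- The shifted factorial (Pochhammer symbol) `(x)_n = x (x+1) ⋯ (x+n-1)`. -/
noncomputable def poch (x : ℝ) (n : ℕ) : ℝ := ∏ i ∈ Finset.range n, (x + i)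

/-- The harmonic numbers of order 2, `H_n^{(2)} = ∑_{j=1}^n 1/j²`. -/
noncomputable def H2 (n : ℕ) : ℝ := ∑ j ∈ Finset.range n, 1 / ((j : ℝ) + 1) ^ 2

/-- The Dirichlet beta value `β(4) = ∑_{k≥0} (-1)^k/(1+2k)⁴`. -/
noncomputable def beta4 : ℝ := ∑' k : ℕ, (-1) ^ k / (1 + 2 * (k : ℝ)) ^ 4

/-- The Catalan constant `G = ∑_{k≥0} (-1)^k/(1+2k)²`. -/
noncomputable def catalanG : ℝ := ∑' k : ℕ, (-1) ^ k / (1 + 2 * (k : ℝ)) ^ 2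

open Filter Topology

theorem poch_succ (x : ℝ) (n : ℕ) : poch x (n + 1) = poch x n * (x + n) := by
  simp [poch, Finset.prod_range_succ]

theorem poch_pos {x : ℝ} (hx : 0 < x) (n : ℕ) : 0 < poch x n :=
  Finset.prod_pos fun i _ => by positivity

theorem H2_succ (n : ℕ) : H2 (n + 1) = H2 n + 1 / ((n : ℝ) + 1) ^ 2 := by
  simp [H2, Finset.sum_range_succ]

theorem H2_nonneg (n : ℕ) : 0 ≤ H2 n :=
  Finset.sum_nonneg fun i _ => by positivity

theorem H2_le_two_sub (n : ℕ) : H2 n ≤ 2 - 1 / ((n : ℝ) + 1 / 2) := by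
  induction n with
  | zero => norm_num [H2]
  | succ n ih =>
    rw [H2_succ]
    push_cast
    have h : 1 / ((n : ℝ) + 1) ^ 2 ≤ 1 / ((n : ℝ) + 1 / 2) - 1 / ((n : ℝ) + 1 + 1 / 2) := by
      rw [div_sub_div _ _ (by positivity) (by positivity),
        div_le_div_iff₀ (by positivity) (by positivity)]
      nlinarith
    linarith

theorem H2_le_two (n : ℕ) : H2 n ≤ 2 := by
  have h : (0 : ℝ) ≤ 1 / ((n : ℝ) + 1 / 2) := by positivity
  linarith [H2_le_two_sub n]

/-- The hypergeometric kernel `(1)_k² (1/2)_n / (3/2)_{2k+n}`. -/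
noncomputable def kernel (n k : ℕ) : ℝ :=
  poch 1 k ^ 2 * poch (1 / 2) n / poch (3 / 2) (2 * k + n)

theorem kernel_pos (n k : ℕ) : 0 < kernel n k := by
  have h1 := poch_pos (x := 1) (by norm_num) k
  have h2 := poch_pos (x := 1 / 2) (by norm_num) n
  have h3 := poch_pos (x := 3 / 2) (by norm_num) (2 * k + n)
  unfold kernel
  positivity

theorem kernel_succ_left (n k : ℕ) :
    kernel (n + 1) k = kernel n k * ((n + 1 / 2) / (n + 2 * k + 3 / 2)) := by
  have h := (poch_pos (x := 3 / 2) (by norm_num) (2 * k + n)).ne'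
  have h' : (n : ℝ) + 2 * k + 3 / 2 ≠ 0 := by positivity
  have h'' : (3 / 2 : ℝ) + (2 * k + n) ≠ 0 := by positivity
  rw [kernel, kernel, ← add_assoc, poch_succ, poch_succ]
  push_cast
  field_simp
  ring

theorem kernel_succ_right (n k : ℕ) :
    kernel n (k + 1) = kernel n k *
      ((k + 1) ^ 2 / ((n + 2 * k + 3 / 2) * (n + 2 * k + 5 / 2))) := by
  have h := (poch_pos (x := 3 / 2) (by norm_num) (2 * k + n)).ne'
  have h1 : (n : ℝ) + 2 * k + 3 / 2 ≠ 0 := by positivity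
  have h2 : (n : ℝ) + 2 * k + 5 / 2 ≠ 0 := by positivity
  have h3 : (3 / 2 : ℝ) + (2 * k + n) ≠ 0 := by positivity
  have h4 : (3 / 2 : ℝ) + (2 * k + n + 1) ≠ 0 := by positivity
  rw [kernel, kernel, show 2 * (k + 1) + n = 2 * k + n + 1 + 1 by ring, poch_succ, poch_succ,
    poch_succ]
  push_cast
  field_simp
  ring

theorem kernel_zero_right (n : ℕ) : kernel n 0 = 1 / (2 * n + 1) := by
  induction n with
  | zero => simp [kernel, poch]
  | succ n ih =>
    rw [kernel_succ_left, ih]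
    push_cast
    field_simp
    ring

theorem kernel_le (n k : ℕ) : kernel n k ≤ (1 / 2) ^ k * (1 / (2 * n + 1)) := by
  induction k with
  | zero => simp [kernel_zero_right]
  | succ k ih =>
    have h : ((k : ℝ) + 1) ^ 2 / ((n + 2 * k + 3 / 2) * (n + 2 * k + 5 / 2)) ≤ 1 / 2 := by
      rw [div_le_div_iff₀ (by positivity) (by norm_num)]
      have hn : (0 : ℝ) ≤ n := n.cast_nonneg
      have hk : (0 : ℝ) ≤ k := k.cast_nonneg
      nlinarith [mul_nonneg hn hk, mul_nonneg hn hn, mul_nonneg hk hk]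
    calc kernel n (k + 1) ≤ kernel n k * (1 / 2) := by
          rw [kernel_succ_right]
          exact mul_le_mul_of_nonneg_left h (kernel_pos n k).le
      _ ≤ (1 / 2) ^ k * (1 / (2 * n + 1)) * (1 / 2) := by gcongr
      _ = _ := by ring

/-- The first member of the telescoping pair. -/
noncomputable def pairF (n k : ℕ) : ℝ :=
  (-1) ^ n * kernel n k * (3 * ((H2 k + 4) / (n + k + 1 / 2) - 1 / (n + k + 1 / 2) ^ 3))

/-- The second member of the telescoping pair. -/
noncomputable def pairG (n k : ℕ) : ℝ :=
  (-1) ^ n * kernel n k * (3 * ((H2 k + 4) * ((n + k + 1 / 2) / 2 + k + 1) /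
    ((n + k + 1 / 2) * (n + 2 * k + 3 / 2)) - 1 / (n + k + 1 / 2) ^ 3))

theorem pairF_sub_pairF (n k : ℕ) :
    pairF n k - pairF n (k + 1) = pairG n k - pairG (n + 1) k := by
  rw [pairF, pairF, pairG, pairG, kernel_succ_left, kernel_succ_right, H2_succ,
    pow_succ (-1 : ℝ) n]
  push_cast
  generalize kernel n k = u
  generalize H2 k = h
  generalize (-1 : ℝ) ^ n = e
  obtain ⟨m, hm⟩ : ∃ m : ℝ, m = n + k + 1 / 2 := ⟨_, rfl⟩
  have hn : (n : ℝ) = m - k - 1 / 2 := by linarith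
  have h0 : m ≠ 0 := by rw [hm]; positivity
  have h1 : m + 1 ≠ 0 := by rw [hm]; positivity
  have h2 : m + k + 1 ≠ 0 := by rw [hm]; positivity
  have h3 : m + k + 2 ≠ 0 := by rw [hm]; positivity
  have h4 : (k : ℝ) + 1 ≠ 0 := by positivity
  rw [hn, show m - k - 1 / 2 + k + 1 / 2 = m by ring,
    show m - k - 1 / 2 + 2 * k + 3 / 2 = m + k + 1 by ring,
    show m - k - 1 / 2 + 2 * k + 5 / 2 = m + k + 2 by ring,
    show m - k - 1 / 2 + (k + 1) + 1 / 2 = m + 1 by ring,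
    show m - k - 1 / 2 + 1 + k + 1 / 2 = m + 1 by ring,
    show m - k - 1 / 2 + 1 / 2 = m - k by ring,
    show m - k - 1 / 2 + 1 + 2 * k + 3 / 2 = m + k + 2 by ring]
  field_simp
  ring

theorem abs_pairF_le (n k : ℕ) :
    |pairF n k| ≤ 60 * (1 / 2) ^ k * (1 / ((n : ℝ) + 1) ^ 2) := by
  have hm : (n : ℝ) + 1 / 2 ≤ n + k + 1 / 2 := by
    have : (0 : ℝ) ≤ k := k.cast_nonneg
    linarith
  have hn : (0 : ℝ) ≤ n := n.cast_nonneg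
  set m : ℝ := n + k + 1 / 2 with hmdef
  have hm0 : 0 < m := by linarith
  have hw : |3 * ((H2 k + 4) / m - 1 / m ^ 3)| ≤ 30 / ((n : ℝ) + 1 / 2) := by
    have h1 : (H2 k + 4) / m ≤ 6 / m := by
      gcongr; linarith [H2_le_two k]
    have h1' : 0 ≤ (H2 k + 4) / m := div_nonneg (by linarith [H2_nonneg k]) hm0.le
    have h2 : 1 / m ^ 3 ≤ 4 / m := by
      rw [div_le_div_iff₀ (by positivity) hm0]
      nlinarith [mul_nonneg hm0.le (show (0 : ℝ) ≤ 4 * m ^ 2 - 1 by nlinarith)]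
    have h2' : 0 ≤ 1 / m ^ 3 := by positivity
    have h3 : 30 / m ≤ 30 / ((n : ℝ) + 1 / 2) := by gcongr
    have h4 : 30 / m = 3 * (6 / m + 4 / m) := by ring
    rw [abs_le]
    constructor <;> linarith
  rw [pairF, abs_mul, abs_mul, abs_pow, abs_neg, abs_one, one_pow, one_mul,
    abs_of_pos (kernel_pos n k)]
  calc kernel n k * |3 * ((H2 k + 4) / m - 1 / m ^ 3)|
      ≤ ((1 / 2) ^ k * (1 / (2 * n + 1))) * (30 / (n + 1 / 2)) := by
        gcongr
        exact kernel_le n k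
    _ = (1 / 2) ^ k * (60 / (2 * n + 1) ^ 2) := by field_simp; ring
    _ ≤ (1 / 2) ^ k * (60 / (n + 1) ^ 2) := by gcongr; linarith
    _ = _ := by ring

theorem abs_pairG_le (n k : ℕ) : |pairG n k| ≤ 60 * (1 / ((n : ℝ) + 1)) := by
  have hn : (0 : ℝ) ≤ n := n.cast_nonneg
  have hk : (0 : ℝ) ≤ k := k.cast_nonneg
  have hw : |3 * ((H2 k + 4) * (((n : ℝ) + k + 1 / 2) / 2 + k + 1) /
      ((n + k + 1 / 2) * (n + 2 * k + 3 / 2)) - 1 / ((n : ℝ) + k + 1 / 2) ^ 3)| ≤ 60 := by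
    have h1 : (H2 k + 4) * (((n : ℝ) + k + 1 / 2) / 2 + k + 1) /
        ((n + k + 1 / 2) * (n + 2 * k + 3 / 2)) ≤ 12 := by
      rw [div_le_iff₀ (by positivity)]
      calc (H2 k + 4) * (((n : ℝ) + k + 1 / 2) / 2 + k + 1)
          ≤ 6 * (n + 2 * k + 3 / 2) := by
            refine mul_le_mul ?_ ?_ (by positivity) (by norm_num) <;>
              linarith [H2_le_two k]
        _ ≤ 12 * ((n + k + 1 / 2) * (n + 2 * k + 3 / 2)) := by nlinarith
    have h1' : 0 ≤ (H2 k + 4) * (((n : ℝ) + k + 1 / 2) / 2 + k + 1) /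
        ((n + k + 1 / 2) * (n + 2 * k + 3 / 2)) := by
      have := H2_nonneg k
      positivity
    have h2 : 1 / ((n : ℝ) + k + 1 / 2) ^ 3 ≤ 8 := by
      calc 1 / ((n : ℝ) + k + 1 / 2) ^ 3 ≤ 1 / (1 / 2) ^ 3 := by gcongr; linarith
        _ = 8 := by norm_num
    have h2' : 0 ≤ 1 / ((n : ℝ) + k + 1 / 2) ^ 3 := by positivity
    rw [abs_le]
    constructor <;> linarith
  rw [pairG, abs_mul, abs_mul, abs_pow, abs_neg, abs_one, one_pow, one_mul,
    abs_of_pos (kernel_pos n k), mul_comm]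
  refine mul_le_mul hw ((kernel_le n k).trans ?_) (kernel_pos n k).le (by norm_num)
  calc (1 / 2 : ℝ) ^ k * (1 / (2 * n + 1)) ≤ 1 * (1 / (n + 1)) := by
        gcongr
        · exact pow_le_one₀ (by norm_num) (by norm_num)
        · linarith
    _ = _ := one_mul _

theorem summable_one_div_succ_sq : Summable fun n : ℕ => 1 / ((n : ℝ) + 1) ^ 2 := by
  have h := (summable_nat_add_iff 1).2 (Real.summable_one_div_nat_pow.2 one_lt_two)
  simpa using h

theorem summable_pairF (k : ℕ) : Summable fun n => pairF n k :=
  (summable_one_div_succ_sq.mul_left (60 * (1 / 2) ^ k)).of_norm_bounded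
    fun n => abs_pairF_le n k

theorem tendsto_pairG (k : ℕ) : Tendsto (fun n => pairG n k) atTop (𝓝 0) := by
  refine squeeze_zero_norm (fun n => abs_pairG_le n k) ?_
  simpa using tendsto_one_div_add_atTop_nhds_zero_nat.const_mul (60 : ℝ)

theorem tsum_pairF_sub (k : ℕ) :
    ∑' n, pairF n k - ∑' n, pairF n (k + 1) = pairG 0 k := by
  have h := ((summable_pairF k).hasSum.sub (summable_pairF (k + 1)).hasSum).tendsto_sum_nat
  have h' : Tendsto (fun N => pairG 0 k - pairG N k) atTop (𝓝 (pairG 0 k)) := by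
    simpa using (tendsto_pairG k).const_sub (pairG 0 k)
  refine tendsto_nhds_unique h (h'.congr fun N => ?_)
  rw [← Finset.sum_range_sub' (fun n => pairG n k)]
  exact Finset.sum_congr rfl fun n _ => (pairF_sub_pairF n k).symm

theorem norm_tsum_pairF_le (k : ℕ) :
    ‖∑' n, pairF n k‖ ≤ 60 * (1 / 2) ^ k * ∑' n : ℕ, 1 / ((n : ℝ) + 1) ^ 2 :=
  tsum_of_norm_bounded (summable_one_div_succ_sq.hasSum.mul_left _) fun n => abs_pairF_le n k

theorem hasSum_pairG_zero : HasSum (fun k => pairG 0 k) (∑' n, pairF n 0) := by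
  have hgeom : Summable fun k : ℕ =>
      60 * (1 / 2 : ℝ) ^ k * ∑' n : ℕ, 1 / ((n : ℝ) + 1) ^ 2 :=
    (summable_geometric_two.mul_left 60).mul_right _
  have hT : Summable fun k => ∑' n, pairF n k := hgeom.of_norm_bounded norm_tsum_pairF_le
  have hG : Summable fun k => pairG 0 k :=
    (hT.sub ((summable_nat_add_iff 1).2 hT)).congr fun k => tsum_pairF_sub k
  rw [hG.hasSum_iff_tendsto_nat]
  have h := hT.tendsto_atTop_zero.const_sub (∑' n, pairF n 0)
  rw [sub_zero] at h
  refine h.congr fun N => ?_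
  rw [← Finset.sum_range_sub' (fun k => ∑' n, pairF n k)]
  exact Finset.sum_congr rfl fun k _ => tsum_pairF_sub k

theorem summable_neg_one_pow_div_odd_pow {p : ℕ} (hp : 2 ≤ p) :
    Summable fun n : ℕ => (-1 : ℝ) ^ n / (1 + 2 * (n : ℝ)) ^ p := by
  refine summable_one_div_succ_sq.of_norm_bounded fun n => ?_
  have hn : (0 : ℝ) ≤ n := n.cast_nonneg
  rw [norm_div, norm_pow, norm_neg, norm_one, one_pow, Real.norm_of_nonneg (by positivity)]
  have h : ((n : ℝ) + 1) ^ 2 ≤ (1 + 2 * (n : ℝ)) ^ p :=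
    calc ((n : ℝ) + 1) ^ 2 ≤ (1 + 2 * (n : ℝ)) ^ 2 := by gcongr ?_ ^ 2; linarith
      _ ≤ _ := pow_le_pow_right₀ (by linarith) hp
  gcongr

theorem tsum_pairF_zero : ∑' n, pairF n 0 = 24 * catalanG - 24 * beta4 := by
  rw [catalanG, beta4, ← tsum_mul_left, ← tsum_mul_left,
    ← ((summable_neg_one_pow_div_odd_pow le_rfl).mul_left 24).tsum_sub
      ((summable_neg_one_pow_div_odd_pow (by norm_num)).mul_left 24)]
  refine tsum_congr fun n => ?_
  have h : (1 : ℝ) + 2 * n ≠ 0 := by positivity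
  rw [pairF, kernel_zero_right, show H2 0 = 0 by simp [H2], Nat.cast_zero,
    show (n : ℝ) + 0 + 1 / 2 = (1 + 2 * n) / 2 by ring, add_comm (2 * (n : ℝ)) 1]
  field_simp
  ring

theorem poch_three_halves_two_mul (k : ℕ) :
    poch (3 / 2) (2 * k) * (2 * k + 3 / 2) =
      3 / 2 * (4 ^ k * (poch (5 / 4) k * poch (7 / 4) k)) := by
  induction k with
  | zero => simp [poch]
  | succ k ih =>
    rw [show 2 * (k + 1) = 2 * k + 1 + 1 by ring, poch_succ, poch_succ, poch_succ, poch_succ]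
    push_cast
    linear_combination (2 * (k : ℝ) + 5 / 2) * (2 * k + 7 / 2) * ih

theorem pairG_zero_left (k : ℕ) :
    pairG 0 k = (1/4 : ℝ) ^ k * (poch 1 k ^ 2 / (poch (5/4) k * poch (7/4) k)) *
      ((5 + 6 * (k : ℝ)) / (1 + 2 * (k : ℝ)) * (H2 k + 4) -
        (24 + 32 * (k : ℝ)) / (1 + 2 * (k : ℝ)) ^ 3) := by
  have h5 := (poch_pos (x := 5 / 4) (by norm_num) k).ne'
  have h7 := (poch_pos (x := 7 / 4) (by norm_num) k).ne'
  have h3 := (poch_pos (x := 3 / 2) (by norm_num) (2 * k)).ne'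
  have hs : (2 * (k : ℝ) + 3 / 2) ≠ 0 := by positivity
  have hm : 1 + 2 * (k : ℝ) ≠ 0 := by positivity
  have hker : kernel 0 k = 2 / 3 * (2 * k + 3 / 2) *
      ((1 / 4) ^ k * (poch 1 k ^ 2 / (poch (5 / 4) k * poch (7 / 4) k))) := by
    have h := poch_three_halves_two_mul k
    have h0 : poch (1 / 2) 0 = 1 := by simp [poch]
    rw [kernel, h0, add_zero, mul_one, one_div_pow, div_eq_iff h3]
    field_simp
    linear_combination (-2 : ℝ) * poch 1 k ^ 2 * h
  rw [pairG, hker, pow_zero, one_mul, Nat.cast_zero,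
    show (0 : ℝ) + k + 1 / 2 = (1 + 2 * k) / 2 by ring,
    show (0 : ℝ) + 2 * k + 3 / 2 = 2 * k + 3 / 2 by ring]
  generalize (1 / 4 : ℝ) ^ k * (poch 1 k ^ 2 / (poch (5 / 4) k * poch (7 / 4) k)) = t
  generalize H2 k = h
  have hs' : 2 * 2 * (k : ℝ) + 3 ≠ 0 := by positivity
  field_simp
  ring

theorem stmt12 :
    (∑' k : ℕ, (1/4 : ℝ) ^ k * (poch 1 k ^ 2 / (poch (5/4) k * poch (7/4) k)) *
      ((5 + 6 * (k : ℝ)) / (1 + 2 * (k : ℝ)) * (H2 k + 4) -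
        (24 + 32 * (k : ℝ)) / (1 + 2 * (k : ℝ)) ^ 3)) = 24 * catalanG - 24 * beta4 := by
  rw [← tsum_pairF_zero, ← hasSum_pairG_zero.tsum_eq]
  exact tsum_congr fun k => (pairG_zero_left k).symm
end

section
/- The infinite series identity $\sum_{k=0}^{\infty}\Big(\frac{-1}{27}\Big)^k\frac{((1)_k)^2}{(7/6)_k\,(11/6)_k}\cdot\frac{83+192k+112k^2}{(1+4k)(3+4k)} = 30G$ holds. -/
open scoped BigOperators

open Filter Topology

theorem poch_zero (x : ℝ) : poch x 0 = 1 := by simp [poch]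

/-- The unsigned hypergeometric part of the Wilf–Zeilberger pair below. -/
noncomputable def wzBase (n k : ℕ) : ℝ :=
  poch 1 n ^ 2 * poch (1 / 2) (n + k) / poch (3 / 2) (3 * n + k)

/-- First member of the Wilf–Zeilberger pair; `wzF 0 k = (-1) ^ k / (1 + 2 k) ^ 2`. -/
noncomputable def wzF (n k : ℕ) : ℝ :=
  (-1) ^ (n + k) * wzBase n k / (4 * n + 2 * k + 1)

/-- Numerator of the certificate of the Wilf–Zeilberger pair. -/
noncomputable def wzNum (n k : ℝ) : ℝ :=
  83 / 2 + 63 * k + 179 * n + 26 * k ^ 2 + 168 * n * k + 248 * n ^ 2 + 4 * k ^ 3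
    + 36 * n * k ^ 2 + 112 * n ^ 2 * k + 112 * n ^ 3

/-- Denominator of the certificate of the Wilf–Zeilberger pair. -/
noncomputable def wzDen (n k : ℝ) : ℝ :=
  (6 * n + 2 * k + 3) * (6 * n + 2 * k + 5) * (4 * n + 2 * k + 3)

/-- Second member of the Wilf–Zeilberger pair. -/
noncomputable def wzG (n k : ℕ) : ℝ :=
  wzF n k * (wzNum n k / wzDen n k)

theorem wzBase_pos (n k : ℕ) : 0 < wzBase n k := by
  have h₁ := poch_pos (x := 1) (by norm_num) n
  have h₂ := poch_pos (x := 1 / 2) (by norm_num) (n + k)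
  have h₃ := poch_pos (x := 3 / 2) (by norm_num) (3 * n + k)
  unfold wzBase
  positivity

theorem wzBase_succ_right (n k : ℕ) :
    wzBase n (k + 1) = wzBase n k * ((2 * n + 2 * k + 1) / (6 * n + 2 * k + 3)) := by
  have h := (poch_pos (x := 3 / 2) (by norm_num) (3 * n + k)).ne'
  unfold wzBase
  rw [← add_assoc, ← add_assoc, poch_succ, poch_succ]
  push_cast
  have h' : (3 / 2 + (3 * n + k) : ℝ) ≠ 0 := by positivity
  field_simp
  ring

theorem wzBase_succ_left (n k : ℕ) :
    wzBase (n + 1) k = wzBase n k * (4 * (n + 1) ^ 2 * (2 * n + 2 * k + 1) /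
      ((6 * n + 2 * k + 3) * (6 * n + 2 * k + 5) * (6 * n + 2 * k + 7))) := by
  have h := (poch_pos (x := 3 / 2) (by norm_num) (3 * n + k)).ne'
  unfold wzBase
  rw [show n + 1 + k = n + k + 1 by ring, show 3 * (n + 1) + k = 3 * n + k + 1 + 1 + 1 by ring]
  simp only [poch_succ]
  push_cast
  have h₁ : (3 / 2 + (3 * n + k) : ℝ) ≠ 0 := by positivity
  have h₂ : (3 / 2 + (3 * n + k + 1) : ℝ) ≠ 0 := by positivity
  have h₃ : (3 / 2 + (3 * n + k + 1 + 1) : ℝ) ≠ 0 := by positivity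
  field_simp
  ring

theorem wzBase_zero_left (k : ℕ) : wzBase 0 k = 1 / (2 * k + 1) := by
  induction k with
  | zero => simp [wzBase, poch_zero]
  | succ k ih =>
    rw [wzBase_succ_right, ih]
    push_cast
    field_simp
    ring

theorem wzBase_le (n k : ℕ) : wzBase n k ≤ (1 / 4) ^ n * (1 / (2 * k + 1)) := by
  induction n with
  | zero => simp [wzBase_zero_left]
  | succ n ih =>
    rw [wzBase_succ_left]
    have h : (4 * (n + 1) ^ 2 * (2 * n + 2 * k + 1) /
        ((6 * n + 2 * k + 3) * (6 * n + 2 * k + 5) * (6 * n + 2 * k + 7)) : ℝ) ≤ 1 / 4 := by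
      rw [div_le_iff₀ (by positivity), ← sub_nonneg]
      ring_nf
      positivity
    calc _ ≤ (1 / 4) ^ n * (1 / (2 * k + 1)) * (1 / 4 : ℝ) :=
          mul_le_mul ih h (by positivity) (by positivity)
      _ = _ := by ring

theorem wz_identity (n k : ℕ) : wzF n k - wzF (n + 1) k = wzG n k - wzG n (k + 1) := by
  unfold wzG wzF wzNum wzDen
  rw [wzBase_succ_left, wzBase_succ_right, show n + 1 + k = n + k + 1 by ring, ← add_assoc,
    pow_succ]
  push_cast
  field_simp
  ring

theorem norm_wzF_le (n k : ℕ) : ‖wzF n k‖ ≤ (1 / 4) ^ n * (1 / (2 * k + 1) ^ 2) := by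
  have h := wzBase_le n k
  have h₀ := wzBase_pos n k
  rw [wzF, norm_div, norm_mul, norm_pow, norm_neg, norm_one, one_pow, one_mul,
    Real.norm_of_nonneg h₀.le, Real.norm_of_nonneg (by positivity)]
  calc _ ≤ (1 / 4) ^ n * (1 / (2 * k + 1)) / (2 * k + 1 : ℝ) := by
        gcongr
        linarith [(Nat.cast_nonneg n : (0 : ℝ) ≤ n)]
    _ = _ := by field_simp

theorem norm_wzG_le (n k : ℕ) : ‖wzG n k‖ ≤ 1 / ((k : ℝ) + 1) := by
  have hq : wzNum n k / wzDen n k ≤ 1 := by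
    unfold wzNum wzDen
    rw [div_le_one (by positivity), ← sub_nonneg]
    ring_nf
    positivity
  have hq₀ : 0 ≤ wzNum n k / wzDen n k := by
    unfold wzNum wzDen
    positivity
  rw [wzG, norm_mul, Real.norm_of_nonneg hq₀]
  calc _ ≤ ‖wzF n k‖ := mul_le_of_le_one_right (norm_nonneg _) hq
    _ ≤ (1 / 4) ^ n * (1 / (2 * k + 1) ^ 2) := norm_wzF_le n k
    _ ≤ 1 * (1 / (2 * k + 1) ^ 2) := by
        gcongr
        exact pow_le_one₀ (by norm_num) (by norm_num)
    _ ≤ 1 / (k + 1) := by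
        rw [one_mul]
        gcongr
        nlinarith [(Nat.cast_nonneg k : (0 : ℝ) ≤ k)]

theorem summable_one_div_odd_sq : Summable fun k : ℕ => 1 / (2 * (k : ℝ) + 1) ^ 2 := by
  have h : Summable fun k : ℕ => 1 / ((k + 1 : ℕ) : ℝ) ^ 2 :=
    (summable_nat_add_iff 1).2 (Real.summable_one_div_nat_pow.2 one_lt_two)
  refine h.of_nonneg_of_le (fun k => by positivity) fun k => ?_
  push_cast
  gcongr
  linarith [(Nat.cast_nonneg k : (0 : ℝ) ≤ k)]

theorem summable_wzF (n : ℕ) : Summable (wzF n) :=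
  (summable_one_div_odd_sq.mul_left _).of_norm_bounded (norm_wzF_le n)

theorem tsum_wzF_sub (n : ℕ) : (∑' k, wzF n k) - ∑' k, wzF (n + 1) k = wzG n 0 := by
  have hG : Tendsto (wzG n) atTop (𝓝 0) :=
    squeeze_zero_norm (norm_wzG_le n) tendsto_one_div_add_atTop_nhds_zero_nat
  have h := ((summable_wzF n).hasSum.sub (summable_wzF (n + 1)).hasSum).tendsto_sum_nat
  simp only [wz_identity, Finset.sum_range_sub'] at h
  simpa using tendsto_nhds_unique h (hG.const_sub (wzG n 0))

theorem norm_tsum_wzF_le (n : ℕ) :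
    ‖∑' k, wzF n k‖ ≤ (1 / 4) ^ n * ∑' k : ℕ, 1 / (2 * (k : ℝ) + 1) ^ 2 := by
  rw [← tsum_mul_left]
  exact tsum_of_norm_bounded (summable_one_div_odd_sq.mul_left _).hasSum (norm_wzF_le n)

theorem hasSum_wzG_zero : HasSum (fun n => wzG n 0) (∑' k, wzF 0 k) := by
  have hS : Summable fun n => ∑' k, wzF n k :=
    ((summable_geometric_of_lt_one (by norm_num) (by norm_num)).mul_right _).of_norm_bounded
      norm_tsum_wzF_le
  have hG : Summable fun n => wzG n 0 := by
    simp only [← tsum_wzF_sub]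
    exact hS.sub ((summable_nat_add_iff 1).2 hS)
  refine (hG.hasSum_iff_tendsto_nat).2 ?_
  simp only [← tsum_wzF_sub, Finset.sum_range_sub']
  simpa using hS.tendsto_atTop_zero.const_sub (∑' k, wzF 0 k)

theorem pow_mul_poch_ratio (n : ℕ) :
    (-1 / 27 : ℝ) ^ n * (poch 1 n ^ 2 / (poch (7 / 6) n * poch (11 / 6) n)) =
      (-1) ^ n * wzBase n 0 * (5 / (6 * n + 5)) := by
  induction n with
  | zero => simp [wzBase, poch_zero]
  | succ n ih =>
    have h₁ := (poch_pos (x := 7 / 6) (by norm_num) n).ne'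
    have h₂ := (poch_pos (x := 11 / 6) (by norm_num) n).ne'
    have h₃ : (7 / 6 + n : ℝ) ≠ 0 := by positivity
    have h₄ : (11 / 6 + n : ℝ) ≠ 0 := by positivity
    calc _ = (-1 / 27 : ℝ) ^ n * (poch 1 n ^ 2 / (poch (7 / 6) n * poch (11 / 6) n)) *
          (-1 / 27 * ((1 + n) ^ 2 / ((7 / 6 + n) * (11 / 6 + n)))) := by
          simp only [poch_succ, pow_succ]
          field_simp
      _ = _ := by
          rw [ih, wzBase_succ_left, pow_succ]
          push_cast
          field_simp
          ring

theorem stmt19 :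
    (∑' k : ℕ, (-1/27 : ℝ) ^ k * (poch 1 k ^ 2 / (poch (7/6) k * poch (11/6) k)) *
      ((83 + 192 * (k : ℝ) + 112 * (k : ℝ) ^ 2) /
        ((1 + 4 * (k : ℝ)) * (3 + 4 * (k : ℝ))))) = 30 * catalanG := by
  have hF : ∑' k, wzF 0 k = catalanG := by
    refine tsum_congr fun k => ?_
    rw [wzF, wzBase_zero_left]
    push_cast
    rw [zero_add]
    field_simp
    ring
  rw [← hF, ← hasSum_wzG_zero.tsum_eq, ← tsum_mul_left]
  refine tsum_congr fun n => ?_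
  rw [pow_mul_poch_ratio, wzG, wzF, wzNum, wzDen]
  push_cast
  field_simp
  ring
end
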